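/- arXiv:1810.09616 — 2 statements merged into one kernel-verified Lean document; each statement's English description precedes it below -/
import Mathlib

section
/- Relative correctness of deterministic programs is equivalent to refinement of projections: let S be a set, R a specification on S, and P and P' deterministic programs on S. Then dom(R ∩ P) ⊆ dom(R ∩ P') if and only if Π_R(P') refines Π_R(P), i.e., if and only if dom(Π_R(P)) ⊆ dom(Π_R(P')) and {(s,s') ∈ Π_R(P') | s ∈ dom(Π_R(P))} ⊆ Π_R(P), where Π_R(Q) = {(s,s') ∈ R ∪ Q | s ∈ dom(R ∩ Q)}. -/
/-- The domain of a relation on `S`. -/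
def Dom {S : Type*} (R : Set (S × S)) : Set S := {s | ∃ s', (s, s') ∈ R}

/-- A relation is deterministic (a function). -/
def Deterministic {S : Type*} (P : Set (S × S)) : Prop :=
  ∀ s s' s'', (s, s') ∈ P → (s, s'') ∈ P → s' = s''

/-- The projection of a program `Q` over a specification `R`. -/
def Proj {S : Type*} (R Q : Set (S × S)) : Set (S × S) :=
  {p | p ∈ R ∪ Q ∧ p.1 ∈ Dom (R ∩ Q)}

/-- For deterministic programs, relative correctness is equivalent to
refinement of projections. -/
theorem more_correct_iff_proj_refines {S : Type*} (R P P' : Set (S × S))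
    (hP : Deterministic P) (hP' : Deterministic P') :
    Dom (R ∩ P) ⊆ Dom (R ∩ P') ↔
      (Dom (Proj R P) ⊆ Dom (Proj R P') ∧
        {p : S × S | p ∈ Proj R P' ∧ p.1 ∈ Dom (Proj R P)} ⊆ Proj R P) := by
  have hd : ∀ Q : Set (S × S), Dom (Proj R Q) = Dom (R ∩ Q) := by
    intro Q
    ext s
    constructor
    · rintro ⟨t, _, h⟩
      exact h
    · rintro ⟨t, h⟩
      exact ⟨t, Or.inl h.1, t, h⟩
  rw [hd, hd]
  constructor
  · intro h
    refine ⟨h, ?_⟩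
    rintro ⟨s, t⟩ ⟨⟨h1, u, hu⟩, h2⟩
    refine ⟨Or.inl ?_, h2⟩
    rcases h1 with h1 | h1
    · exact h1
    · rw [hP' s t u h1 hu.2]
      exact hu.1
  · exact fun h => h.1
end

section
/- Relative correctness of (possibly non-deterministic) programs is equivalent to refinement of projections: let S be a set and R, P, P' arbitrary relations on S. Then P' is more-correct than P with respect to R in the non-deterministic sense — i.e., dom(R ∩ P) ⊆ dom(R ∩ P') and {(s,s') ∈ P' | s ∈ dom(R ∩ P) and (s,s') ∉ R} ⊆ P — if and only if Π_R(P') refines Π_R(P), i.e., dom(Π_R(P)) ⊆ dom(Π_R(P')) and {(s,s') ∈ Π_R(P') | s ∈ dom(Π_R(P))} ⊆ Π_R(P), where Π_R(Q) = {(s,s') ∈ R ∪ Q | s ∈ dom(R ∩ Q)}. -/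
theorem dom_proj_eq {S : Type*} (R Q : Set (S × S)) : Dom (Proj R Q) = Dom (R ∩ Q) := by
  ext s
  constructor
  · rintro ⟨s', _, h⟩
    exact h
  · rintro ⟨s', h⟩
    exact ⟨s', Or.inl h.1, s', h⟩

/-- For arbitrary (possibly non-deterministic) programs, relative correctness
in the non-deterministic sense is equivalent to refinement of projections. -/
theorem nondet_more_correct_iff_proj_refines {S : Type*} (R P P' : Set (S × S)) :
    (Dom (R ∩ P) ⊆ Dom (R ∩ P') ∧
      {p : S × S | p ∈ P' ∧ p.1 ∈ Dom (R ∩ P) ∧ p ∉ R} ⊆ P) ↔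
      (Dom (Proj R P) ⊆ Dom (Proj R P') ∧
        {p : S × S | p ∈ Proj R P' ∧ p.1 ∈ Dom (Proj R P)} ⊆ Proj R P) := by
  rw [dom_proj_eq, dom_proj_eq]
  refine and_congr_right fun hd => ⟨?_, ?_⟩
  · rintro h p ⟨⟨hp, _⟩, hs⟩
    refine ⟨?_, hs⟩
    by_cases hR : p ∈ R
    · exact Or.inl hR
    · exact Or.inr (h ⟨hp.resolve_left hR, hs, hR⟩)
  · rintro h p ⟨hp, hs, hR⟩
    exact (h ⟨⟨Or.inr hp, hd hs⟩, hs⟩).1.resolve_left hR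
end
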